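/- arXiv:1710.04333 — 13 statements merged into one kernel-verified Lean document; each statement's English description precedes it below -/
import Mathlib

section
/- Let G = (V, E) be a digraph, let M be a weak module of G, and let N be a strong module of G containing M that is minimal with this property (every strong module of G containing M contains N). Then: M is a series module iff N is a series module; M is a parallel module iff N is a parallel module; and M is an ordered module iff N is an ordered module. -/
namespace PaperMD

variable {V : Type*}

/-- `M` is a module of the digraph with edge relation `E`: it is nonempty and
every outside vertex relates uniformly to all of `M`. -/
def IsModule (E : V → V → Prop) (M : Set V) : Prop :=
  M.Nonempty ∧ ∀ x ∉ M, ∀ a ∈ M, ∀ b ∈ M, (E x a ↔ E x b) ∧ (E a x ↔ E b x)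

/-- Two vertex sets overlap: they intersect, but neither contains the other. -/
def Overlap (A B : Set V) : Prop :=
  (A ∩ B).Nonempty ∧ ¬A ⊆ B ∧ ¬B ⊆ A

/-- A strong module: a module overlapping no module. -/
def IsStrongModule (E : V → V → Prop) (M : Set V) : Prop :=
  IsModule E M ∧ ∀ N : Set V, IsModule E N → ¬Overlap M N

/-- `a` and `b` are quotient-distinct in the module `M`: they are distinct members of `M`
and no strong module properly contained in `M` contains both. -/
def QuotDistinct (E : V → V → Prop) (M : Set V) (a b : V) : Prop :=
  a ∈ M ∧ b ∈ M ∧ a ≠ b ∧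
    ∀ S : Set V, IsStrongModule E S → S ⊂ M → ¬(a ∈ S ∧ b ∈ S)

/-- `M` is a series module: every quotient-distinct pair is joined by edges both ways. -/
def IsSeries (E : V → V → Prop) (M : Set V) : Prop :=
  IsModule E M ∧ ∀ a b, QuotDistinct E M a b → E a b ∧ E b a

/-- `M` is a parallel module: no edges between quotient-distinct pairs. -/
def IsParallel (E : V → V → Prop) (M : Set V) : Prop :=
  IsModule E M ∧ ∀ a b, QuotDistinct E M a b → ¬E a b ∧ ¬E b a

/-- `M` is an ordered module: quotient-distinct pairs are joined by exactly one directed edge,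
and these edges are transitive on quotient-distinct triples. -/
def IsOrdered (E : V → V → Prop) (M : Set V) : Prop :=
  IsModule E M ∧
    (∀ a b, QuotDistinct E M a b → Xor' (E a b) (E b a)) ∧
    (∀ a b c, QuotDistinct E M a b → QuotDistinct E M b c → QuotDistinct E M a c →
      E a b → E b c → E a c)

/-- Undirected closure `U(G)`: edge set `E ∪ E⁻¹`. -/
def UClos (E : V → V → Prop) : V → V → Prop := fun a b => E a b ∨ E b a

/-- Transitive closure `G*`: `a ≠ b` and a nonempty directed path from `a` to `b`. -/
def TClos (E : V → V → Prop) : V → V → Prop :=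
  fun a b => a ≠ b ∧ Relation.TransGen E a b

/-- `G` is acyclic: no nonempty directed path leads from a vertex back to itself. -/
def Acyclic (E : V → V → Prop) : Prop := ∀ a, ¬Relation.TransGen E a a

/-- `G` is transitive: `(a,b), (b,c) ∈ E` with `a ≠ c` implies `(a,c) ∈ E`. -/
def TransRel (E : V → V → Prop) : Prop := ∀ a b c, E a b → E b c → a ≠ c → E a c

/-- `G` is transitively reduced: no edge `(a,b)` admits a directed path from `a` to `b`
of length at least 2. -/
def TransReduced (E : V → V → Prop) : Prop :=
  ∀ a b, E a b → ¬∃ c, E a c ∧ Relation.TransGen E c b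

/-- Undirected complement of a digraph: all pairs `(a,b)`, `a ≠ b`, adjacent in
neither direction. -/
def UComp (E : V → V → Prop) : V → V → Prop :=
  fun a b => a ≠ b ∧ ¬E a b ∧ ¬E b a

/-- `seq(a,b)`: `(a,b) ∈ E`, `b` is the only successor of `a`, `a` the only
predecessor of `b`. -/
def SeqR (E : V → V → Prop) (a b : V) : Prop :=
  a ≠ b ∧ E a b ∧ (∀ c, E a c → c = b) ∧ (∀ c, E c b → c = a)

/-- `par(a,b)`: distinct vertices with identical predecessor and successor sets. -/
def ParR (E : V → V → Prop) (a b : V) : Prop :=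
  a ≠ b ∧ ∀ c, (E c a ↔ E c b) ∧ (E a c ↔ E b c)

/-- Mutual reachability (reflexive): `a = b`, or nonempty directed paths both ways. -/
def MutReach (E : V → V → Prop) (a b : V) : Prop :=
  a = b ∨ (Relation.TransGen E a b ∧ Relation.TransGen E b a)

/-- The forcing relation `Γ` between edges of an undirected graph `D`. -/
def Forces (D : V → V → Prop) (p q : V × V) : Prop :=
  D p.1 p.2 ∧ D q.1 q.2 ∧
    ((p.1 = q.1 ∧ p.2 ≠ q.2 ∧ ¬D p.2 q.2) ∨ (p.2 = q.2 ∧ p.1 ≠ q.1 ∧ ¬D p.1 q.1))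

/-- `F` is an orientation of the undirected graph `D`: `F ⊆ D` and for each edge of `D`
exactly one direction lies in `F`. -/
def IsOrientation (D F : V → V → Prop) : Prop :=
  (∀ a b, F a b → D a b) ∧ ∀ a b, D a b → Xor' (F a b) (F b a)

/-- A transitive orientation of the undirected graph `D`. -/
def IsTransOrientation (D F : V → V → Prop) : Prop :=
  IsOrientation D F ∧ ∀ a b c, F a b → F b c → a ≠ c → F a c

/-- All pairs in `A × B` have the same adjacency type: forward edge iff `p`, backward edge
iff `q`. -/
def UniformPair (E : V → V → Prop) (p q : Prop) (A B : Set V) : Prop :=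
  ∀ a ∈ A, ∀ b ∈ B, (E a b ↔ p) ∧ (E b a ↔ q)

/-- `Q` splits into two nonempty disjoint parts `A` and `B` forming a uniform pair. -/
structure IsCut (E : V → V → Prop) (p q : Prop) (Q A B : Set V) : Prop where
  left_nonempty : A.Nonempty
  right_nonempty : B.Nonempty
  disjoint : Disjoint A B
  union_eq : A ∪ B = Q
  uniform : UniformPair E p q A B

theorem UniformPair.symm {E : V → V → Prop} {p q : Prop} {A B : Set V}
    (h : UniformPair E p q A B) : UniformPair E q p B A :=
  fun b hb a ha => (h a ha b hb).symm

theorem IsModule.union {E : V → V → Prop} {M P : Set V} (hM : IsModule E M)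
    (hP : IsModule E P) (h : (M ∩ P).Nonempty) : IsModule E (M ∪ P) := by
  obtain ⟨y, hyM, hyP⟩ := h
  refine ⟨⟨y, Or.inl hyM⟩, fun x hx => ?_⟩
  have hxM : x ∉ M := fun h => hx (Or.inl h)
  have hxP : x ∉ P := fun h => hx (Or.inr h)
  have key : ∀ a ∈ M ∪ P, (E x a ↔ E x y) ∧ (E a x ↔ E y x) := by
    rintro a (ha | ha)
    · exact hM.2 x hxM a ha y hyM
    · exact hP.2 x hxP a ha y hyP
  intro a ha b hb
  exact ⟨(key a ha).1.trans (key b hb).1.symm, (key a ha).2.trans (key b hb).2.symm⟩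

theorem Overlap.exists_uniformPair {E : V → V → Prop} {M P : Set V}
    (hM : IsModule E M) (hP : IsModule E P) (h : Overlap M P) :
    ∃ p q : Prop, UniformPair E p q (M \ P) P ∧ UniformPair E p q M (P \ M) := by
  obtain ⟨-, h₁, h₂⟩ := h
  obtain ⟨x, hxM, hxP⟩ := Set.not_subset.1 h₁
  obtain ⟨z, hzP, hzM⟩ := Set.not_subset.1 h₂
  have cross : UniformPair E (E x z) (E z x) M (P \ M) := by
    rintro a ha b ⟨hb, hbM⟩
    have e₁ := hM.2 b hbM a ha x hxM
    have e₂ := hP.2 x hxP b hb z hzP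
    exact ⟨e₁.2.trans e₂.1, e₁.1.trans e₂.2⟩
  refine ⟨E x z, E z x, ?_, cross⟩
  rintro a ⟨ha, haP⟩ b hb
  have e₁ := hP.2 a haP b hb z hzP
  have e₂ := cross a ha z ⟨hzP, hzM⟩
  exact ⟨e₁.1.trans e₂.1, e₁.2.trans e₂.2⟩

theorem Overlap.subset_strong {E : V → V → Prop} {M N P : Set V}
    (hN : IsStrongModule E N) (hMN : M ⊆ N) (hP : IsModule E P) (h : Overlap M P) : P ⊆ N := by
  by_contra hPN
  obtain ⟨⟨y, hyM, hyP⟩, h₁, -⟩ := h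
  exact hN.2 P hP ⟨⟨y, hMN hyM, hyP⟩, fun hNP => h₁ (hMN.trans hNP), hPN⟩

theorem exists_overlap_of_weak {E : V → V → Prop} {M : Set V} (hM : IsModule E M)
    (hweak : ¬IsStrongModule E M) : ∃ P, IsModule E P ∧ Overlap M P := by
  by_contra! h
  exact hweak ⟨hM, h⟩

theorem isStrongModule_singleton (E : V → V → Prop) (x : V) :
    IsStrongModule E {x} := by
  refine ⟨⟨Set.singleton_nonempty x, ?_⟩, ?_⟩
  · rintro y - a rfl b rfl
    exact ⟨Iff.rfl, Iff.rfl⟩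
  · rintro P - ⟨⟨y, rfl, hy⟩, h, -⟩
    exact h (Set.singleton_subset_iff.2 hy)

theorem exists_quotDistinct [Finite V] {E : V → V → Prop} {M : Set V}
    (hM : M.Nontrivial) : ∃ a b, QuotDistinct E M a b := by
  obtain ⟨x, hx⟩ := hM.nonempty
  have hx' : ({x} : Set V) ⊂ M :=
    (Set.singleton_subset_iff.2 hx).ssubset_of_ne fun h => hM.ne_singleton h.symm
  obtain ⟨S, -, hS⟩ := (Set.toFinite {S | IsStrongModule E S ∧ S ⊂ M ∧ x ∈ S}).exists_le_maximal
    ⟨isStrongModule_singleton E x, hx', rfl⟩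
  obtain ⟨hSs, hSM, hxS⟩ := hS.prop
  obtain ⟨y, hyM, hyS⟩ := Set.exists_of_ssubset hSM
  refine ⟨x, y, hx, hyM, fun h => hyS (h ▸ hxS), ?_⟩
  rintro T hT hTM ⟨hxT, hyT⟩
  refine hSs.2 T hT.1 ⟨⟨x, hxS, hxT⟩, fun hST => ?_, fun hTS => hyS (hTS hyT)⟩
  exact hyS (hS.le_of_ge ⟨hT, hTM, hxT⟩ hST hyT)

/-- The minimal strong module containing a weak module admits a cut. -/
theorem exists_isCut_of_weak [Finite V] {E : V → V → Prop} {M N : Set V}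
    (hM : IsModule E M) (hweak : ¬IsStrongModule E M) (hN : IsStrongModule E N) (hMN : M ⊆ N)
    (hmin : ∀ S : Set V, IsStrongModule E S → M ⊆ S → N ⊆ S) :
    ∃ p q A B, IsCut E p q N A B := by
  have split : ∀ Q P, IsModule E Q → IsModule E P → Overlap Q P →
      ∃ p q A B, IsCut E p q (Q ∪ P) A B := by
    intro Q P hQ hP h
    obtain ⟨p, q, h₁, -⟩ := h.exists_uniformPair hQ hP
    exact ⟨p, q, Q \ P, P, Set.nonempty_of_not_subset fun hs => h.2.1 hs, hP.1,
      Set.disjoint_sdiff_left, Set.sdiff_union_self, h₁⟩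
  obtain ⟨P, hP, hMP⟩ := exists_overlap_of_weak hM hweak
  obtain ⟨Q, -, hQ⟩ := (Set.toFinite {Q | IsModule E Q ∧ M ⊆ Q ∧ Q ⊆ N ∧
    ∃ p q A B, IsCut E p q Q A B}).exists_le_maximal
    ⟨hM.union hP hMP.1, Set.subset_union_left,
      Set.union_subset hMN (hMP.subset_strong hN hMN hP), split M P hM hP hMP⟩
  obtain ⟨hQm, hMQ, hQN, hcut⟩ := hQ.prop
  have hQs : IsStrongModule E Q := by
    refine ⟨hQm, fun R hR hQR => hQR.2.2 ?_⟩
    exact Set.subset_union_right.trans (hQ.le_of_ge ⟨hQm.union hR hQR.1,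
      hMQ.trans Set.subset_union_left, Set.union_subset hQN (hQR.subset_strong hN hQN hR),
      split Q R hQm hR hQR⟩ Set.subset_union_left)
  rwa [hQN.antisymm (hmin Q hQs hMQ)] at hcut

/-- `S` is an interval in a decomposition of `N` into consecutive parts `L`, `S`, `R`, every
earlier part forming a uniform pair with every later one. -/
structure IsInterval (E : V → V → Prop) (p q : Prop) (N L S R : Set V) : Prop where
  union_eq : L ∪ S ∪ R = N
  disjoint_left : Disjoint L S
  disjoint_right : Disjoint S R
  disjoint_outer : Disjoint L R
  uniform_left : UniformPair E p q L S
  uniform_right : UniformPair E p q S R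
  uniform_outer : UniformPair E p q L R

theorem IsInterval.isModule {E : V → V → Prop} {p q : Prop} {N L S R : Set V}
    (h : IsInterval E p q N L S R) (hN : IsModule E N) (hS : S.Nonempty) : IsModule E S := by
  refine ⟨hS, fun x hx a ha b hb => ?_⟩
  have hSN : S ⊆ N := by
    rw [← h.union_eq]
    exact fun y hy => Or.inl (Or.inr hy)
  by_cases hxN : x ∈ N
  · rw [← h.union_eq] at hxN
    obtain (hxL | hxS) | hxR := hxN
    · have e₁ := h.uniform_left x hxL a ha
      have e₂ := h.uniform_left x hxL b hb
      exact ⟨e₁.1.trans e₂.1.symm, e₁.2.trans e₂.2.symm⟩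
    · exact absurd hxS hx
    · have e₁ := h.uniform_right a ha x hxR
      have e₂ := h.uniform_right b hb x hxR
      exact ⟨e₁.2.trans e₂.2.symm, e₁.1.trans e₂.1.symm⟩
  · exact hN.2 x hxN a (hSN ha) b (hSN hb)

/-- An interval that is cut yields two smaller intervals. -/
theorem IsInterval.refine {E : V → V → Prop} {p q : Prop} {N L S R A B : Set V}
    (h : IsInterval E p q N L S R) (hc : IsCut E p q S A B) :
    IsInterval E p q N L A (B ∪ R) ∧ IsInterval E p q N (L ∪ A) B R := by
  obtain ⟨h₁, h₂, h₃, h₄, h₅, h₆, h₇⟩ := h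
  obtain ⟨-, -, hd, rfl, hu⟩ := hc
  simp only [Set.disjoint_union_left, Set.disjoint_union_right] at h₂ h₃
  constructor
  · refine ⟨?_, h₂.1, ?_, ?_, ?_, ?_, ?_⟩
    · rw [← h₁]; ext; simp only [Set.mem_union]; tauto
    · exact Set.disjoint_union_right.2 ⟨hd, h₃.1⟩
    · exact Set.disjoint_union_right.2 ⟨h₂.2, h₄⟩
    · exact fun a ha b hb => h₅ a ha b (Or.inl hb)
    · rintro a ha b (hb | hb)
      · exact hu a ha b hb
      · exact h₆ a (Or.inl ha) b hb
    · rintro a ha b (hb | hb)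
      · exact h₅ a ha b (Or.inr hb)
      · exact h₇ a ha b hb
  · refine ⟨?_, ?_, h₃.2, ?_, ?_, ?_, ?_⟩
    · rw [← h₁]; ext; simp only [Set.mem_union]; tauto
    · exact Set.disjoint_union_left.2 ⟨h₂.2, hd⟩
    · exact Set.disjoint_union_left.2 ⟨h₄, h₃.1⟩
    · rintro a (ha | ha) b hb
      · exact h₅ a ha b (Or.inr hb)
      · exact hu a ha b hb
    · exact fun a ha b hb => h₆ a (Or.inr ha) b hb
    · rintro a (ha | ha) b hb
      · exact h₇ a ha b hb
      · exact h₆ a (Or.inl ha) b hb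

/-- A nonempty weak interval of a strong module admits a cut of the same type. -/
theorem IsInterval.exists_isCut {E : V → V → Prop} {p q : Prop} {N L S R : Set V}
    (h : IsInterval E p q N L S R) (hN : IsStrongModule E N) (hS : S.Nonempty)
    (hweak : ¬IsStrongModule E S) : ∃ A B, IsCut E p q S A B := by
  have hSm := h.isModule hN.1 hS
  have hSN : S ⊆ N := by
    rw [← h.union_eq]
    exact fun y hy => Or.inl (Or.inr hy)
  obtain ⟨P, hP, hSP⟩ := exists_overlap_of_weak hSm hweak
  obtain ⟨c, d, hc₁, hc₂⟩ := hSP.exists_uniformPair hSm hP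
  have hPN := hSP.subset_strong hN hSN hP
  obtain ⟨hi, h₁, h₂⟩ := hSP
  obtain ⟨x, hxP, hxS⟩ := Set.not_subset.1 h₂
  obtain ⟨y, hyS, -⟩ := id hi
  have hyx := hc₂ y hyS x ⟨hxP, hxS⟩
  have hne : (S \ P).Nonempty := Set.nonempty_of_not_subset fun hs => h₁ hs
  have hcut : IsCut E c d S (S \ P) (S ∩ P) :=
    ⟨hne, hi, Set.disjoint_sdiff_inter, Set.sdiff_union_inter S P,
      fun a ha b hb => hc₁ a ha b hb.2⟩
  have hxN := hPN hxP
  rw [← h.union_eq] at hxN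
  obtain (hxL | hxS') | hxR := hxN
  · have e := h.uniform_left x hxL y hyS
    have hd : d = p := propext (hyx.2.symm.trans e.1)
    have hc : c = q := propext (hyx.1.symm.trans e.2)
    subst hd hc
    exact ⟨S ∩ P, S \ P, hi, hne, hcut.disjoint.symm, Set.inter_union_sdiff S P,
      hcut.uniform.symm⟩
  · exact absurd hxS' hxS
  · have e := h.uniform_right y hyS x hxR
    have hc : c = p := propext (hyx.1.symm.trans e.1)
    have hd : d = q := propext (hyx.2.symm.trans e.2)
    subst hc hd
    exact ⟨_, _, hcut⟩

/-- In a strong module admitting a cut, quotient-distinct pairs are separated by a cut of the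
same type. -/
theorem QuotDistinct.exists_isCut [Finite V] {E : V → V → Prop} {p q : Prop}
    {N A B : Set V} (hN : IsStrongModule E N) (hcut : IsCut E p q N A B) {a b : V}
    (hab : QuotDistinct E N a b) :
    ∃ L R, L ∪ R = N ∧ UniformPair E p q L R ∧ (a ∈ L ∧ b ∈ R ∨ b ∈ L ∧ a ∈ R) := by
  obtain ⟨haN, hbN, -, hsep⟩ := hab
  have h₀ : IsInterval E p q N ∅ N ∅ := by
    refine ⟨by simp, by simp, by simp, by simp, ?_, ?_, ?_⟩ <;> intro x hx y hy <;> simp_all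
  obtain ⟨S, -, hS⟩ := (Set.toFinite {S | a ∈ S ∧ b ∈ S ∧
    ∃ L R, IsInterval E p q N L S R}).exists_le_minimal ⟨haN, hbN, ∅, ∅, h₀⟩
  obtain ⟨haS, hbS, L, R, hI⟩ := hS.prop
  have hSN : S ⊆ N := by
    rw [← hI.union_eq]
    exact fun y hy => Or.inl (Or.inr hy)
  obtain ⟨C, D, hCD⟩ : ∃ C D, IsCut E p q S C D := by
    by_cases hSs : IsStrongModule E S
    · rcases hSN.eq_or_ssubset with rfl | hlt
      · exact ⟨A, B, hcut⟩
      · exact absurd ⟨haS, hbS⟩ (hsep S hSs hlt)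
    · exact hI.exists_isCut hN ⟨a, haS⟩ hSs
  obtain ⟨hI₁, hI₂⟩ := hI.refine hCD
  refine ⟨L ∪ C, D ∪ R, ?_, ?_, ?_⟩
  · rw [← hI₁.union_eq]
  · rintro x (hx | hx) y hy
    · exact hI₁.uniform_outer x hx y hy
    · exact hI₁.uniform_right x hx y hy
  · have hCS : C ⊆ S := hCD.union_eq ▸ Set.subset_union_left
    have hDS : D ⊆ S := hCD.union_eq ▸ Set.subset_union_right
    have hC : ¬(a ∈ C ∧ b ∈ C) := fun h => by
      obtain ⟨y, hy⟩ := hCD.right_nonempty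
      exact Set.disjoint_left.1 hCD.disjoint
        (hS.le_of_le ⟨h.1, h.2, _, _, hI₁⟩ hCS (hDS hy)) hy
    have hD : ¬(a ∈ D ∧ b ∈ D) := fun h => by
      obtain ⟨y, hy⟩ := hCD.left_nonempty
      exact Set.disjoint_left.1 hCD.disjoint hy
        (hS.le_of_le ⟨h.1, h.2, _, _, hI₂⟩ hDS (hCS hy))
    rw [← hCD.union_eq] at haS hbS
    simp only [Set.mem_union] at haS hbS ⊢
    tauto

/-- Quotient-distinctness in a module agrees with that in its minimal strong supermodule. -/
theorem quotDistinct_iff_of_minimal {E : V → V → Prop} {M N : Set V}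
    (hM : IsModule E M) (hMN : M ⊆ N)
    (hmin : ∀ S : Set V, IsStrongModule E S → M ⊆ S → N ⊆ S) {a b : V} :
    QuotDistinct E M a b ↔ a ∈ M ∧ b ∈ M ∧ QuotDistinct E N a b := by
  constructor
  · rintro ⟨ha, hb, hne, h⟩
    refine ⟨ha, hb, hMN ha, hMN hb, hne, fun S hS hSN hab => ?_⟩
    have hMS : ¬M ⊆ S := fun hMS => hSN.2 (hmin S hS hMS)
    have hSM : S ⊆ M := by
      by_contra hSM
      exact hS.2 M hM ⟨⟨a, hab.1, ha⟩, hSM, hMS⟩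
    exact h S hS ⟨hSM, hMS⟩ hab
  · rintro ⟨ha, hb, -, -, hne, h⟩
    exact ⟨ha, hb, hne, fun S hS hSM => h S hS (hSM.trans_subset hMN)⟩

/-- A weak module `M` is series/parallel/ordered iff the minimal strong module
`N` containing it is series/parallel/ordered. -/
theorem stmt0 {V : Type*} [Fintype V] (E : V → V → Prop) (hirr : Irreflexive E)
    (M N : Set V) (hM : IsModule E M) (hweak : ¬IsStrongModule E M)
    (hN : IsStrongModule E N) (hMN : M ⊆ N)
    (hmin : ∀ S : Set V, IsStrongModule E S → M ⊆ S → N ⊆ S) :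
    (IsSeries E M ↔ IsSeries E N) ∧ (IsParallel E M ↔ IsParallel E N) ∧
      (IsOrdered E M ↔ IsOrdered E N) := by
  have hQD : ∀ {a b}, QuotDistinct E M a b ↔ a ∈ M ∧ b ∈ M ∧ QuotDistinct E N a b :=
    quotDistinct_iff_of_minimal hM hMN hmin
  obtain ⟨p, q, A, B, hcut⟩ := exists_isCut_of_weak hM hweak hN hMN hmin
  have hsep := fun a b (hab : QuotDistinct E N a b) => hab.exists_isCut hN hcut
  have htype : ∀ a b, QuotDistinct E N a b →
      (E a b ↔ p) ∧ (E b a ↔ q) ∨ (E b a ↔ p) ∧ (E a b ↔ q) := by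
    intro a b hab
    obtain ⟨L, R, -, hu, ⟨ha, hb⟩ | ⟨hb, ha⟩⟩ := hsep a b hab
    · exact Or.inl (hu a ha b hb)
    · exact Or.inr (hu b hb a ha)
  have hnt : M.Nontrivial := by
    obtain ⟨P, -, ⟨x, hxM, hxP⟩, h₁, -⟩ := exists_overlap_of_weak hM hweak
    obtain ⟨y, hyM, hyP⟩ := Set.not_subset.1 h₁
    exact ⟨x, hxM, y, hyM, fun h => hyP (h ▸ hxP)⟩
  obtain ⟨a₀, b₀, h₀⟩ := exists_quotDistinct (E := E) hnt
  have t₀ := htype a₀ b₀ (hQD.1 h₀).2.2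
  refine ⟨⟨fun h => ⟨hN.1, fun a b hab => ?_⟩, fun h => ⟨hM, fun a b hab => ?_⟩⟩,
    ⟨fun h => ⟨hN.1, fun a b hab => ?_⟩, fun h => ⟨hM, fun a b hab => ?_⟩⟩,
    fun h => ?_, fun h => ⟨hM, fun a b hab => ?_, fun a b c hab hbc hac => ?_⟩⟩
  · have := h.2 a₀ b₀ h₀
    have := htype a b hab
    tauto
  · exact h.2 a b (hQD.1 hab).2.2
  · have := h.2 a₀ b₀ h₀
    have := htype a b hab
    tauto
  · exact h.2 a b (hQD.1 hab).2.2
  · have hpq : p ∧ ¬q ∨ q ∧ ¬p := by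
      have h₁ : E a₀ b₀ ∧ ¬E b₀ a₀ ∨ E b₀ a₀ ∧ ¬E a₀ b₀ := h.2.1 a₀ b₀ h₀
      rcases t₀ with ⟨e, f⟩ | ⟨e, f⟩ <;> rw [e, f] at h₁
      · exact h₁
      · exact h₁.symm
    have hnpq : ¬(p ∧ q) := by
      rintro ⟨hp, hq⟩
      exact hpq.elim (fun h => h.2 hq) (fun h => h.2 hp)
    refine ⟨hN.1, fun a b hab => ?_, fun a b c hab hbc _ hE₁ hE₂ => ?_⟩
    · change E a b ∧ ¬E b a ∨ E b a ∧ ¬E a b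
      rcases htype a b hab with ⟨e, f⟩ | ⟨e, f⟩ <;> rw [e, f]
      · exact hpq
      · exact hpq.symm
    · obtain ⟨L, R, hLR, hu, hs⟩ := hsep a b hab
      have hc : c ∈ L ∪ R := hLR ▸ hbc.2.1
      obtain ⟨ha, hb⟩ | ⟨hb, ha⟩ := hs
      · have hp := (hu a ha b hb).1.1 hE₁
        obtain hc | hc := hc
        · exact absurd ⟨hp, (hu c hc b hb).2.1 hE₂⟩ hnpq
        · exact (hu a ha c hc).1.2 hp
      · have hq := (hu b hb a ha).2.1 hE₁
        obtain hc | hc := hc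
        · exact (hu c hc a ha).2.2 hq
        · exact absurd ⟨(hu b hb c hc).1.1 hE₂, hq⟩ hnpq
  · exact h.2.1 a b (hQD.1 hab).2.2
  · exact h.2.2 a b c (hQD.1 hab).2.2 (hQD.1 hbc).2.2 (hQD.1 hac).2.2

end PaperMD
end

section
/- Let G = (V, E) be a digraph and M a module of G. If M can be partitioned into two nonempty disjoint subsets M₁, M₂ with M₁ × M₂ ⊆ E and M₂ × M₁ ⊆ E, then M is a series module of G. -/
namespace PaperMD

variable {V : Type*}

/-- `a` and `b` are members of `M` that are not joined by edges in both directions. -/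
def NotJoined (E : V → V → Prop) (M : Set V) (a b : V) : Prop :=
  a ∈ M ∧ b ∈ M ∧ ¬(E a b ∧ E b a)

/-- The co-component of `a` in `M`: everything reachable from `a` through pairs of members of `M`
that are not joined in both directions. -/
def coComponent (E : V → V → Prop) (M : Set V) (a : V) : Set V :=
  {x | Relation.ReflTransGen (NotJoined E M) a x}

theorem NotJoined.symm {E : V → V → Prop} {M : Set V} {a b : V} (h : NotJoined E M a b) :
    NotJoined E M b a :=
  ⟨h.2.1, h.1, fun hE => h.2.2 hE.symm⟩

/-- A path from a point of `N` to a point outside `N` has a step leaving `N`. -/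
theorem exists_step_leaving {r : V → V → Prop} {N : Set V} {x y : V}
    (h : Relation.ReflTransGen r x y) (hx : x ∈ N) (hy : y ∉ N) :
    ∃ u v, Relation.ReflTransGen r x u ∧ r u v ∧ u ∈ N ∧ v ∉ N := by
  induction h with
  | refl => exact absurd hx hy
  | @tail b c hab hbc ih =>
    by_cases hb : b ∈ N
    · exact ⟨b, c, hab, hbc, hb, hy⟩
    · exact ih hb

theorem coComponent_subset {E : V → V → Prop} {M : Set V} {a : V} (ha : a ∈ M) :
    coComponent E M a ⊆ M := by
  intro x hx
  rcases Relation.ReflTransGen.cases_tail hx with rfl | ⟨_, _, h⟩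
  · exact ha
  · exact h.2.1

theorem joined_of_mem_of_notMem_coComponent {E : V → V → Prop} {M : Set V} {a x y : V}
    (ha : a ∈ M) (hx : x ∈ coComponent E M a) (hy : y ∈ M) (hyC : y ∉ coComponent E M a) :
    E x y ∧ E y x := by
  by_contra h
  exact hyC (Relation.ReflTransGen.tail hx ⟨coComponent_subset ha hx, hy, h⟩)

theorem isModule_coComponent {E : V → V → Prop} {M : Set V} {a : V} (hM : IsModule E M)
    (ha : a ∈ M) : IsModule E (coComponent E M a) := by
  refine ⟨⟨a, Relation.ReflTransGen.refl⟩, fun x hx b hb c hc => ?_⟩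
  by_cases hxM : x ∈ M
  · have h₁ := joined_of_mem_of_notMem_coComponent ha hb hxM hx
    have h₂ := joined_of_mem_of_notMem_coComponent ha hc hxM hx
    exact ⟨iff_of_true h₁.2 h₂.2, iff_of_true h₁.1 h₂.1⟩
  · exact hM.2 x hxM b (coComponent_subset ha hb) c (coComponent_subset ha hc)

/-- A co-component that does not exhaust the module is a strong module. -/
theorem isStrongModule_coComponent {E : V → V → Prop} {M : Set V} {a w : V} (hM : IsModule E M)
    (ha : a ∈ M) (hw : w ∈ M) (hwC : w ∉ coComponent E M a) :
    IsStrongModule E (coComponent E M a) := by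
  refine ⟨isModule_coComponent hM ha, ?_⟩
  rintro N hN ⟨⟨y, hyC, hyN⟩, hCN, hNC⟩
  obtain ⟨z, hzC, hzN⟩ := Set.not_subset.mp hCN
  obtain ⟨x, hxN, hxC⟩ := Set.not_subset.mp hNC
  have hya : Relation.ReflTransGen (NotJoined E M) y a :=
    haveI : Std.Symm (NotJoined E M) := ⟨fun _ _ h => h.symm⟩
    Relation.ReflTransGen.stdSymm.symm _ _ hyC
  obtain ⟨u, v, hyu, huv, huN, hvN⟩ := exists_step_leaving (hya.trans hzC) hyN hzN
  have huC : u ∈ coComponent E M a := Relation.ReflTransGen.trans hyC hyu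
  have hvC : v ∈ coComponent E M a := Relation.ReflTransGen.tail huC huv
  have hvux := hN.2 v hvN u huN x hxN
  suffices h : E v x ∧ E x v from huv.2.2 ⟨hvux.2.mpr h.2, hvux.1.mpr h.1⟩
  by_cases hxM : x ∈ M
  · exact joined_of_mem_of_notMem_coComponent ha hvC hxM hxC
  by_cases hwN : w ∈ N
  · have h := joined_of_mem_of_notMem_coComponent ha hvC hw hwC
    have hvwx := hN.2 v hvN w hwN x hxN
    exact ⟨hvwx.1.mp h.1, hvwx.2.mp h.2⟩
  · have h := joined_of_mem_of_notMem_coComponent ha huC hw hwC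
    have hwux := hN.2 w hwN u huN x hxN
    have hxwv := hM.2 x hxM w hw v huv.2.1
    exact ⟨hxwv.2.mp (hwux.1.mp h.2), hxwv.1.mp (hwux.2.mp h.1)⟩

/-- A subset of `M` joined in both directions to its complement in `M` contains the co-component
of each of its members. -/
theorem coComponent_subset_of_joined {E : V → V → Prop} {M A : Set V} {a : V} (ha : a ∈ A)
    (h : ∀ x ∈ A, ∀ y ∈ M, y ∉ A → E x y ∧ E y x) : coComponent E M a ⊆ A := by
  intro x hx
  by_contra hxA
  obtain ⟨u, v, -, huv, hu, hv⟩ := exists_step_leaving hx ha hxA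
  exact huv.2.2 (h u hu v huv.2.1 hv)

/-- a module that splits into two nonempty parts completely joined
in both directions is a series module. -/
theorem stmt1 {V : Type*} [Fintype V] (E : V → V → Prop) (hirr : Irreflexive E)
    (M M₁ M₂ : Set V) (hM : IsModule E M)
    (h1 : M₁.Nonempty) (h2 : M₂.Nonempty) (hdisj : Disjoint M₁ M₂)
    (hpart : M₁ ∪ M₂ = M)
    (h12 : ∀ a ∈ M₁, ∀ b ∈ M₂, E a b)
    (h21 : ∀ a ∈ M₂, ∀ b ∈ M₁, E a b) :
    IsSeries E M := by
  refine ⟨hM, fun a b ⟨ha, hb, _, hS⟩ => ?_⟩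
  by_contra hab
  obtain ⟨w, hw, hwC⟩ : ∃ w ∈ M, w ∉ coComponent E M a := by
    subst hpart
    rcases ha with ha | ha
    · obtain ⟨w, hw⟩ := h2
      refine ⟨w, Or.inr hw, fun hwC => Set.disjoint_left.mp hdisj ?_ hw⟩
      refine coComponent_subset_of_joined ha (fun x hx y hy hyA => ?_) hwC
      have hy2 := hy.resolve_left hyA
      exact ⟨h12 x hx y hy2, h21 y hy2 x hx⟩
    · obtain ⟨w, hw⟩ := h1
      refine ⟨w, Or.inl hw, fun hwC => Set.disjoint_left.mp hdisj hw ?_⟩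
      refine coComponent_subset_of_joined ha (fun x hx y hy hyA => ?_) hwC
      have hy1 := hy.resolve_right hyA
      exact ⟨h21 x hx y hy1, h12 y hy1 x hx⟩
  exact hS _ (isStrongModule_coComponent hM ha hw hwC)
    ⟨coComponent_subset ha, fun h => hwC (h hw)⟩
    ⟨Relation.ReflTransGen.refl, Relation.ReflTransGen.single ⟨ha, hb, hab⟩⟩

end PaperMD
end

section
/- Let G = (V, E) be a transitive acyclic digraph. Then a set M ⊆ V is a strong module of G if and only if M is a strong module of the undirected closure U(G). -/
namespace PaperMD

variable {V : Type*}

theorem isModule_uClos_iff {E : V → V → Prop} {M : Set V} :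
    IsModule (UClos E) M ↔
      M.Nonempty ∧ ∀ x ∉ M, ∀ a ∈ M, ∀ b ∈ M, UClos E x a → UClos E x b := by
  refine and_congr_right fun _ => ⟨fun h x hx a ha b hb => (h x hx a ha b hb).1.1, ?_⟩
  intro h x hx a ha b hb
  have h₁ := h x hx a ha b hb
  have h₂ := h x hx b hb a ha
  unfold UClos at *
  grind

theorem IsModule.uClos {E : V → V → Prop} {M : Set V} (h : IsModule E M) :
    IsModule (UClos E) M := by
  refine ⟨h.1, fun x hx a ha b hb => ?_⟩
  have := h.2 x hx a ha b hb
  unfold UClos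
  grind

/-- A strong module of the undirected closure of a strict order is order-convex. -/
theorem IsStrongModule.not_between {E : V → V → Prop} (irr : ∀ a, ¬E a a)
    (tr : ∀ a b c, E a b → E b c → E a c) {M : Set V} (hM : IsStrongModule (UClos E) M)
    {x a b : V} (hx : x ∉ M) (ha : a ∈ M) (hb : b ∈ M) (hbx : E b x) : ¬E x a := by
  intro hxa
  obtain ⟨hmod, hstrong⟩ := hM
  have hu := (isModule_uClos_iff.1 hmod).2
  set N : Set V := {m | m ∈ M ∧ E x m} ∪ {y | y ∉ M ∧ ∃ p ∈ M, ∃ q ∈ M, E p y ∧ E y q}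
  have hxN : x ∈ N := Or.inr ⟨hx, b, hb, a, ha, hbx, hxa⟩
  have hbN : b ∉ N := by
    rintro (⟨-, h⟩ | ⟨h, -⟩)
    · exact irr b (tr _ _ _ hbx h)
    · exact h hb
  refine hstrong N (isModule_uClos_iff.2 ⟨⟨x, hxN⟩, ?_⟩)
    ⟨⟨a, ha, Or.inl ⟨ha, hxa⟩⟩, fun h => hbN (h hb), fun h => hx (h hxN)⟩
  intro z hz u hu' v hv huv
  by_cases hzM : z ∈ M
  · have hzx : E z x := by
      have h₁ : UClos E x z := hu x hx a ha z hzM (Or.inl hxa)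
      rcases h₁ with h₁ | h₁
      · exact absurd (Or.inl ⟨hzM, h₁⟩) hz
      · exact h₁
    rcases hv with ⟨-, hv⟩ | ⟨hvM, p, hp, q, hq, hpv, hvq⟩
    · exact Or.inl (tr _ _ _ hzx hv)
    · exact (hu v hvM p hp z hzM (Or.inr hpv)).symm
  · have key : ∀ w ∈ N, UClos E z w ↔ UClos E z a := by
      rintro w (⟨hw, -⟩ | ⟨hwM, p, hp, q, hq, hpw, hwq⟩)
      · exact ⟨hu z hzM w hw a ha, hu z hzM a ha w hw⟩
      · constructor
        · rintro (h | h)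
          · exact hu z hzM q hq a ha (Or.inl (tr _ _ _ h hwq))
          · exact hu z hzM p hp a ha (Or.inr (tr _ _ _ hpw h))
        · intro h
          rcases hu z hzM a ha p hp h with h₁ | h₁
          · exact Or.inl (tr _ _ _ h₁ hpw)
          rcases hu z hzM a ha q hq h with h₂ | h₂
          · exact absurd (Or.inr ⟨hzM, p, hp, q, hq, h₁, h₂⟩) hz
          · exact Or.inr (tr _ _ _ hwq h₂)
    exact (key v hv).2 ((key u hu').1 huv)

theorem IsStrongModule.isModule_of_uClos {E : V → V → Prop} (irr : ∀ a, ¬E a a)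
    (tr : ∀ a b c, E a b → E b c → E a c) {M : Set V} (hM : IsStrongModule (UClos E) M) :
    IsModule E M := by
  refine ⟨hM.1.1, fun x hx a ha b hb => ?_⟩
  have h := (hM.1.2 x hx a ha b hb).1
  have h₁ := hM.not_between irr tr hx ha hb
  have h₂ := hM.not_between irr tr hx hb ha
  unfold UClos at h
  grind

theorem IsModule.uClos_union {E : V → V → Prop} {M N : Set V} (hM : IsModule (UClos E) M)
    (hN : IsModule (UClos E) N) (h : (M ∩ N).Nonempty) : IsModule (UClos E) (M ∪ N) := by
  rw [isModule_uClos_iff] at *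
  obtain ⟨r, hrM, hrN⟩ := h
  refine ⟨⟨r, Or.inl hrM⟩, fun x hx a ha b hb hab => ?_⟩
  simp only [Set.mem_union, not_or] at hx
  have hr : UClos E x r := by
    rcases ha with ha | ha
    · exact hM.2 x hx.1 a ha r hrM hab
    · exact hN.2 x hx.2 a ha r hrN hab
  rcases hb with hb | hb
  · exact hM.2 x hx.1 r hrM b hb hr
  · exact hN.2 x hx.2 r hrN b hb hr

/-- The order-convex hull of a vertex set. -/
def orderHull (E : V → V → Prop) (P : Set V) : Set V :=
  P ∪ {z | ∃ p ∈ P, ∃ q ∈ P, E p z ∧ E z q}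

theorem IsModule.orderHull {E : V → V → Prop} (tr : ∀ a b c, E a b → E b c → E a c)
    {P : Set V} (hP : IsModule (UClos E) P) : IsModule E (orderHull E P) := by
  obtain ⟨⟨r, hr⟩, hu⟩ := isModule_uClos_iff.1 hP
  refine ⟨⟨r, Or.inl hr⟩, fun x hx => ?_⟩
  obtain ⟨hxP, hxb⟩ : x ∉ P ∧ ¬∃ p ∈ P, ∃ q ∈ P, E p x ∧ E x q := not_or.1 hx
  have hu := hu x hxP
  have key : ∀ a ∈ PaperMD.orderHull E P, (E x a ↔ E x r) ∧ (E a x ↔ E r x) := by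
    unfold UClos at hu
    rintro a (ha | ⟨p, hp, q, hq, hpa, haq⟩)
    · have := hu a ha r hr
      have := hu r hr a ha
      grind
    · have := hu p hp r hr
      have := hu r hr p hp
      have := hu q hq r hr
      have := hu r hr q hq
      have := tr x p a
      have := tr p a x
      have := tr a q x
      have := tr x a q
      grind
  intro a ha b hb
  exact ⟨(key a ha).1.trans (key b hb).1.symm, (key a ha).2.trans (key b hb).2.symm⟩

/-- In a strict order, a set whose incomparability graph is disconnected splits into a
nonempty lower part lying entirely below a nonempty upper part. -/
theorem exists_order_split {E : V → V → Prop} (irr : ∀ a, ¬E a a)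
    (tr : ∀ a b c, E a b → E b c → E a c) {M N : Set V} {p r : V} (hpM : p ∈ M) (hpN : p ∉ N)
    (hrM : r ∈ M) (hrN : r ∈ N) (h : ∀ a ∈ M, a ∉ N → ∀ b ∈ M, b ∈ N → UClos E a b) :
    ∃ T ⊆ M, T.Nonempty ∧ (M \ T).Nonempty ∧ ∀ l ∈ M \ T, ∀ t ∈ T, E l t := by
  set S : Set V := {s | Relation.ReflTransGen (fun x y => y ∈ M ∧ ¬UClos E x y) r s}
  have hrS : r ∈ S := Relation.ReflTransGen.refl
  have hstep : ∀ s ∈ S, ∀ y ∈ M, y ∉ S → UClos E s y := fun s hs y hy hyS =>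
    by_contra fun hc => hyS (Relation.ReflTransGen.tail hs ⟨hy, hc⟩)
  have hSMN : ∀ s ∈ S, s ∈ M ∧ s ∈ N := by
    intro s hs
    induction hs with
    | refl => exact ⟨hrM, hrN⟩
    | tail _ hxy ih =>
      refine ⟨hxy.1, by_contra fun hc => hxy.2 (h _ hxy.1 hc _ ih.1 ih.2).symm⟩
  have hpS : p ∉ S := fun hc => hpN (hSMN p hc).2
  have below : ∀ m ∈ M, m ∉ S → E m r → ∀ s ∈ S, E m s := by
    intro m hm hmS hmr s hs
    induction hs with
    | refl => exact hmr
    | tail hx hxy ih =>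
      rcases hstep _ (Relation.ReflTransGen.tail hx hxy) m hm hmS with h₁ | h₁
      · exact absurd (Or.inr (tr _ _ _ h₁ ih)) hxy.2
      · exact h₁
  have above : ∀ m ∈ M, m ∉ S → E r m → ∀ s ∈ S, E s m := by
    intro m hm hmS hmr s hs
    induction hs with
    | refl => exact hmr
    | tail hx hxy ih =>
      rcases hstep _ (Relation.ReflTransGen.tail hx hxy) m hm hmS with h₁ | h₁
      · exact h₁
      · exact absurd (Or.inl (tr _ _ _ ih h₁)) hxy.2
  have hcomp : ∀ m ∈ M, m ∉ S → E r m ∨ E m r := hstep r hrS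
  rcases hcomp p hpM hpS with hrp | hpr
  · refine ⟨{m | m ∈ M ∧ m ∉ S ∧ E r m}, fun m hm => hm.1, ⟨p, hpM, hpS, hrp⟩,
      ⟨r, hrM, fun hc => hc.2.1 hrS⟩, ?_⟩
    rintro l ⟨hl, hlT⟩ t ⟨ht, htS, hrt⟩
    by_cases hlS : l ∈ S
    · exact above t ht htS hrt l hlS
    · rcases hcomp l hl hlS with h₁ | h₁
      · exact absurd ⟨hl, hlS, h₁⟩ hlT
      · exact tr _ _ _ h₁ hrt
  · refine ⟨{m | m ∈ M ∧ (m ∈ S ∨ E r m)}, fun m hm => hm.1, ⟨r, hrM, Or.inl hrS⟩,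
      ⟨p, hpM, ?_⟩, ?_⟩
    · rintro ⟨-, hc | hc⟩
      · exact hpS hc
      · exact irr _ (tr _ _ _ hc hpr)
    · rintro l ⟨hl, hlT⟩ t ⟨ht, htS⟩
      have hlS : l ∉ S := fun hc => hlT ⟨hl, Or.inl hc⟩
      have hlr : E l r := (hcomp l hl hlS).resolve_left fun hc => hlT ⟨hl, Or.inr hc⟩
      rcases htS with htS | htS
      · exact below l hl hlS hlr t htS
      · exact tr _ _ _ hlr htS

theorem IsModule.of_not_uClos {E : V → V → Prop} (tr : ∀ a b c, E a b → E b c → E a c)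
    {M N : Set V} (hM : IsModule E M) (hN : IsModule (UClos E) N) {p q r : V}
    (hp : p ∈ M) (hpN : p ∉ N) (hq : q ∈ N) (hqM : q ∉ M) (hrM : r ∈ M) (hrN : r ∈ N)
    (h : ¬UClos E p q) : IsModule E N := by
  have huM := (isModule_uClos_iff.1 hM.uClos).2
  have huN := (isModule_uClos_iff.1 hN).2
  have hpn : ∀ n ∈ N, ¬UClos E p n := fun n hn hc => h (huN p hpN n hn q hq hc)
  have key : ∀ z ∉ N, ∀ a ∈ N, ∀ b ∈ N, E b z → ¬E z a := by
    intro z hz a ha b hb hbz hza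
    have hzM : z ∉ M := by
      intro hzM
      have h₁ : UClos E z q := huN z hz a ha q hq (Or.inl hza)
      exact h (huM q hqM z hzM p hp h₁.symm).symm
    have hzr : UClos E z r := huN z hz a ha r hrN (Or.inl hza)
    rcases huM z hzM r hrM p hp hzr with h₁ | h₁
    · exact hpn b hb (Or.inr (tr _ _ _ hbz h₁))
    · exact hpn a ha (Or.inl (tr _ _ _ h₁ hza))
  refine ⟨hN.1, fun z hz a ha b hb => ?_⟩
  have h₁ := key z hz a ha b hb
  have h₂ := key z hz b hb a ha
  have h₃ := huN z hz a ha b hb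
  have h₄ := huN z hz b hb a ha
  unfold UClos at h₃ h₄
  grind

theorem IsStrongModule.uClos {E : V → V → Prop} (irr : ∀ a, ¬E a a)
    (tr : ∀ a b c, E a b → E b c → E a c) {M : Set V} (hM : IsStrongModule E M) :
    IsStrongModule (UClos E) M := by
  obtain ⟨hmod, hstrong⟩ := hM
  refine ⟨hmod.uClos, ?_⟩
  rintro N hN ⟨⟨r, hrM, hrN⟩, hMN, hNM⟩
  obtain ⟨p, hp, hpN⟩ := Set.not_subset.1 hMN
  obtain ⟨q, hq, hqM⟩ := Set.not_subset.1 hNM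
  by_cases hpq : UClos E p q
  swap
  · exact hstrong N (hmod.of_not_uClos tr hN hp hpN hq hqM hrM hrN hpq)
      ⟨⟨r, hrM, hrN⟩, hMN, hNM⟩
  have huM := (isModule_uClos_iff.1 hmod.uClos).2
  have huN := (isModule_uClos_iff.1 hN).2
  obtain ⟨T, hTM, ⟨t, ht⟩, ⟨l, hl⟩, hsplit⟩ :=
    exists_order_split irr tr hp hpN hrM hrN fun a ha haN b _ hb =>
      huN a haN q hq b hb (huM q hqM p hp a ha hpq.symm).symm
  have hH : IsModule E (orderHull E (M ∪ N)) :=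
    (hmod.uClos.uClos_union hN ⟨r, hrM, hrN⟩).orderHull tr
  have hMH : M ⊆ orderHull E (M ∪ N) := fun m hm => Or.inl (Or.inl hm)
  have hqH : q ∈ orderHull E (M ∪ N) := Or.inl (Or.inr hq)
  generalize hHdef : orderHull E (M ∪ N) = H at hH hMH hqH
  have hcomp : ∀ z ∈ H, z ∉ M → UClos E z r := by
    intro z hz hzM
    by_cases hzN : z ∈ N
    · exact huM z hzM p hp r hrM (huN p hpN q hq z hzN hpq).symm
    · rw [← hHdef] at hz
      rcases hz with (hz | hz) | ⟨x, hx | hx, -, -, hxz, -⟩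
      · exact absurd hz hzM
      · exact absurd hz hzN
      · exact huM z hzM x hx r hrM (Or.inr hxz)
      · exact huN z hzN x hx r hrN (Or.inr hxz)
  have hup : ∀ z ∈ H, z ∉ M → E r z → ∀ m ∈ M, E m z := fun z _ hzM h m hm =>
    (hmod.2 z hzM r hrM m hm).2.1 h
  have hdown : ∀ z ∈ H, z ∉ M → E z r → ∀ m ∈ M, E z m := fun z _ hzM h m hm =>
    (hmod.2 z hzM r hrM m hm).1.1 h
  rcases hcomp q hqH hqM with hqr | hrq
  · refine hstrong ((M \ T) ∪ {z | z ∈ H ∧ z ∉ M ∧ E z r}) ⟨⟨l, Or.inl hl⟩, ?_⟩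
      ⟨⟨l, hl.1, Or.inl hl⟩, fun h => ?_, fun h => hqM (h (Or.inr ⟨hqH, hqM, hqr⟩))⟩
    · intro x hx a ha b hb
      by_cases hxH : x ∈ H
      · have key : ∀ w ∈ (M \ T) ∪ {z | z ∈ H ∧ z ∉ M ∧ E z r}, E w x := by
          by_cases hxM : x ∈ M
          · have hxT : x ∈ T := by_contra fun hc => hx (Or.inl ⟨hxM, hc⟩)
            rintro w (hw | ⟨hwH, hwM, hwr⟩)
            · exact hsplit w hw x hxT
            · exact hdown w hwH hwM hwr x hxM
          · have hrx : E r x :=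
              (hcomp x hxH hxM).resolve_left fun hc => hx (Or.inr ⟨hxH, hxM, hc⟩)
            rintro w (hw | ⟨hwH, hwM, hwr⟩)
            · exact hup x hxH hxM hrx w hw.1
            · exact tr _ _ _ hwr hrx
        have := key a ha
        have := key b hb
        grind
      · have hsub : (M \ T) ∪ {z | z ∈ H ∧ z ∉ M ∧ E z r} ⊆ H :=
          Set.union_subset (fun w hw => hMH hw.1) fun w hw => hw.1
        exact hH.2 x hxH a (hsub ha) b (hsub hb)
    · rcases h (hTM ht) with h | h
      · exact h.2 ht
      · exact h.2.1 (hTM ht)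
  · refine hstrong (T ∪ {z | z ∈ H ∧ z ∉ M ∧ E r z}) ⟨⟨t, Or.inl ht⟩, ?_⟩
      ⟨⟨t, hTM ht, Or.inl ht⟩, fun h => ?_, fun h => hqM (h (Or.inr ⟨hqH, hqM, hrq⟩))⟩
    · intro x hx a ha b hb
      by_cases hxH : x ∈ H
      · have key : ∀ w ∈ T ∪ {z | z ∈ H ∧ z ∉ M ∧ E r z}, E x w := by
          by_cases hxM : x ∈ M
          · have hxT : x ∉ T := fun hc => hx (Or.inl hc)
            rintro w (hw | ⟨hwH, hwM, hwr⟩)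
            · exact hsplit x ⟨hxM, hxT⟩ w hw
            · exact hup w hwH hwM hwr x hxM
          · have hxr : E x r :=
              (hcomp x hxH hxM).resolve_right fun hc => hx (Or.inr ⟨hxH, hxM, hc⟩)
            rintro w (hw | ⟨hwH, hwM, hwr⟩)
            · exact hdown x hxH hxM hxr w (hTM hw)
            · exact tr _ _ _ hxr hwr
        have := key a ha
        have := key b hb
        grind
      · have hsub : T ∪ {z | z ∈ H ∧ z ∉ M ∧ E r z} ⊆ H :=
          Set.union_subset (fun w hw => hMH (hTM hw)) fun w hw => hw.1
        exact hH.2 x hxH a (hsub ha) b (hsub hb)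
    · rcases h hl.1 with h | h
      · exact hl.2 h
      · exact h.2.1 hl.1

/-- for a transitive acyclic digraph, strong modules coincide with
the strong modules of its undirected closure. -/
theorem stmt2 {V : Type*} [Fintype V] (E : V → V → Prop) (hirr : Irreflexive E)
    (htrans : TransRel E) (hacyc : Acyclic E) (M : Set V) :
    IsStrongModule E M ↔ IsStrongModule (UClos E) M := by
  have tr : ∀ a b c, E a b → E b c → E a c := fun a b c hab hbc =>
    htrans a b c hab hbc fun hac => hacyc a (.tail (.single hab) (hac ▸ hbc))
  refine ⟨fun h => h.uClos hirr tr, fun h => ⟨h.isModule_of_uClos hirr tr, fun N hN => ?_⟩⟩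
  exact h.2 N hN.uClos

end PaperMD
end

section
/- Let G = (V, E) be a transitive digraph (not necessarily acyclic). Then every strong module of the undirected closure U(G) is a strong module of G. -/
namespace PaperMD

variable {V : Type*}

/-- The vertices joined to `x` by edges both ways, together with `x`, form a module. -/
theorem TransRel.isModule_twins {E : V → V → Prop} (htrans : TransRel E) (x : V) :
    IsModule E {z | z = x ∨ (E x z ∧ E z x)} := by
  have key : ∀ y a b, ¬(y = x ∨ (E x y ∧ E y x)) → (a = x ∨ (E x a ∧ E a x)) →
      (b = x ∨ (E x b ∧ E b x)) → (E y a → E y b) ∧ (E a y → E b y) := by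
    intro y a b hy ha hb
    have hyx : y ≠ x := fun h => hy (Or.inl h)
    have hyb : y ≠ b := fun h => hy (h ▸ hb)
    constructor
    · intro h
      have h1 : E y x := by
        rcases ha with rfl | ha
        · exact h
        · exact htrans _ _ _ h ha.2 hyx
      rcases hb with rfl | hb
      · exact h1
      · exact htrans _ _ _ h1 hb.1 hyb
    · intro h
      have h1 : E x y := by
        rcases ha with rfl | ha
        · exact h
        · exact htrans _ _ _ ha.1 h hyx.symm
      rcases hb with rfl | hb
      · exact h1
      · exact htrans _ _ _ hb.2 h1 hyb.symm
  refine ⟨⟨x, Or.inl rfl⟩, fun y hy a ha b hb => ?_⟩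
  have h1 := key y a b hy ha hb
  have h2 := key y b a hy hb ha
  exact ⟨⟨h1.1, h2.1⟩, ⟨h1.2, h2.2⟩⟩

/-- If a module `M` of the undirected closure splits into a lower part `A` and an upper part `B`,
then `A` together with all outside vertices lying between `A` and `B` is again a module of the
undirected closure, provided each element of `A` precedes each element of `B`. -/
theorem TransRel.isModule_uClos_between {E : V → V → Prop} (htrans : TransRel E) {M A B : Set V}
    (hM : IsModule (UClos E) M) (hAB : A ∪ B = M) (hA : A.Nonempty) (hB : B.Nonempty)
    (hlt : ∀ a ∈ A, ∀ b ∈ B, E a b) :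
    IsModule (UClos E) (A ∪ {z | z ∉ M ∧ (∀ a ∈ A, E a z) ∧ ∀ b ∈ B, E z b}) := by
  set N : Set V := A ∪ {z | z ∉ M ∧ (∀ a ∈ A, E a z) ∧ ∀ b ∈ B, E z b} with hN
  have hAM : ∀ a ∈ A, a ∈ M := fun a ha => hAB ▸ Or.inl ha
  have hBM : ∀ b ∈ B, b ∈ M := fun b hb => hAB ▸ Or.inr hb
  have hNB : ∀ n ∈ N, ∀ b ∈ B, E n b := by
    rintro n (hn | hn) b hb
    · exact hlt n hn b hb
    · exact hn.2.2 b hb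
  have key : ∀ y ∉ N, ∀ p ∈ N, ∀ q ∈ N, UClos E y p → UClos E y q := by
    intro y hy p hp q hq hyp
    have hyq : y ≠ q := fun h => hy (h ▸ hq)
    by_cases hyM : y ∈ M
    · rcases hAB.symm ▸ hyM with h | h
      · exact absurd (Or.inl h) hy
      · exact Or.inr (hNB q hq y h)
    have hne : ∀ m ∈ M, y ≠ m := fun m hm h => hyM (h ▸ hm)
    have hadj : ∃ m ∈ M, UClos E y m := by
      rcases hp with hp | hp
      · exact ⟨p, hAM p hp, hyp⟩
      · obtain ⟨a, ha⟩ := hA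
        obtain ⟨b, hb⟩ := hB
        rcases hyp with h | h
        · exact ⟨b, hBM b hb, Or.inl (htrans _ _ _ h (hp.2.2 b hb) (hne b (hBM b hb)))⟩
        · exact ⟨a, hAM a ha, Or.inr (htrans _ _ _ (hp.2.1 a ha) h (hne a (hAM a ha)).symm)⟩
    obtain ⟨m, hm, hym⟩ := hadj
    have hall : ∀ m' ∈ M, UClos E y m' := fun m' hm' => (hM.2 y hyM m hm m' hm').1.1 hym
    by_contra hcon
    rcases hq with hqA | hqZ
    · exact hcon (hall q (hAM q hqA))
    refine hy (Or.inr ⟨hyM, fun a ha => ?_, fun b hb => ?_⟩)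
    · exact (hall a (hAM a ha)).resolve_left fun h =>
        hcon (Or.inl (htrans _ _ _ h (hqZ.2.1 a ha) hyq))
    · exact (hall b (hBM b hb)).resolve_right fun h =>
        hcon (Or.inr (htrans _ _ _ (hqZ.2.2 b hb) h hyq.symm))
  refine ⟨hA.mono Set.subset_union_left, fun y hy p hp q hq => ?_⟩
  have h : UClos E y p ↔ UClos E y q := ⟨key y hy p hp q hq, key y hy q hq p hp⟩
  exact ⟨h, by simpa only [UClos, or_comm] using h⟩

theorem TransRel.isModule_of_isStrongModule_uClos {E : V → V → Prop} (htrans : TransRel E)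
    {M : Set V} (hM : IsStrongModule (UClos E) M) : IsModule E M := by
  refine ⟨hM.1.1, fun x hx a ha b hb => ?_⟩
  by_cases htwin : ∃ m ∈ M, E x m ∧ E m x
  · obtain ⟨m, hm, hxm⟩ := htwin
    have hsub : M ⊆ {z | z = x ∨ (E x z ∧ E z x)} := by
      by_contra hsub
      exact hM.2 _ (htrans.isModule_twins x).uClos
        ⟨⟨m, hm, Or.inr hxm⟩, hsub, fun h => hx (h (Or.inl rfl))⟩
    have hboth : ∀ z ∈ M, E x z ∧ E z x := fun z hz =>
      (hsub hz).resolve_left fun h => hx (h ▸ hz)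
    have h1 := hboth a ha
    have h2 := hboth b hb
    tauto
  push Not at htwin
  by_cases hbetween : ∃ p ∈ M, ∃ q ∈ M, E p x ∧ E x q
  · exfalso
    obtain ⟨p, hp, q, hq, hpx, hxq⟩ := hbetween
    have hall : ∀ m ∈ M, E x m ∨ E m x := fun m hm =>
      (hM.1.2 x hx q hq m hm).1.1 (Or.inl hxq)
    refine hM.2 _ (htrans.isModule_uClos_between (A := {m | m ∈ M ∧ E m x})
      (B := {m | m ∈ M ∧ E x m}) hM.1 ?_ ⟨p, hp, hpx⟩ ⟨q, hq, hxq⟩ ?_) ⟨?_, ?_, ?_⟩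
    · ext m
      have := hall m
      simp only [Set.mem_union, Set.mem_ofPred_eq]
      tauto
    · rintro s ⟨hs, hsx⟩ t ⟨ht, hxt⟩
      exact htrans _ _ _ hsx hxt fun h => htwin t ht hxt (h ▸ hsx)
    · exact ⟨p, hp, Or.inl ⟨hp, hpx⟩⟩
    · intro h
      rcases h hq with h | h
      · exact htwin q hq hxq h.2
      · exact h.1 hq
    · exact fun h => hx (h (Or.inr ⟨hx, fun _ h => h.2, fun _ h => h.2⟩))
  · push Not at hbetween
    have hU : (E x a ∨ E a x) ↔ (E x b ∨ E b x) := (hM.1.2 x hx a ha b hb).1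
    have h1 := hbetween a ha b hb
    have h2 := hbetween b hb a ha
    have h3 := htwin a ha
    have h4 := htwin b hb
    tauto

/-- for a transitive digraph, every strong module of the undirected closure
is a strong module of the digraph itself. -/
theorem stmt3 {V : Type*} [Fintype V] (E : V → V → Prop) (hirr : Irreflexive E)
    (htrans : TransRel E) (M : Set V) (hM : IsStrongModule (UClos E) M) :
    IsStrongModule E M := by
  exact ⟨htrans.isModule_of_isStrongModule_uClos hM, fun N hN => hM.2 N hN.uClos⟩

end PaperMD
end

section
/- Let G = (V, E) be a digraph and let a, b be vertices with seq(a,b). Then there does not exist any vertex x ∈ V with par(a,x) or par(b,x). -/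
namespace PaperMD

variable {V : Type*}

/-- if `seq(a,b)` holds then no vertex `x` satisfies `par(a,x)` or `par(b,x)`. -/
theorem stmt5 {V : Type*} [Fintype V] (E : V → V → Prop) (hirr : Irreflexive E)
    (a b : V) (h : SeqR E a b) :
    ¬∃ x : V, ParR E a x ∨ ParR E b x := by
  obtain ⟨_, hab, hsucc, hpred⟩ := h
  rintro ⟨x, ⟨hne, hx⟩ | ⟨hne, hx⟩⟩
  · exact hne (hpred x ((hx b).2.mp hab)).symm
  · exact hne (hsucc x ((hx a).1.mp hab)).symm

end PaperMD
end

section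
/- Let G = (V, E) be a digraph and let a, b be vertices with seq(a,b). Then {a, b} is a module of the transitive closure G* of G, and (a,b) is an edge of G*. -/
namespace PaperMD

variable {V : Type*}

/-- Every path out of `x ≠ a` into `b` passes through the only predecessor `a` of `b`. -/
theorem transGen_iff_of_unique_pred {E : V → V → Prop} {a b x : V} (hab : E a b)
    (hpred : ∀ c, E c b → c = a) (hxa : x ≠ a) :
    Relation.TransGen E x a ↔ Relation.TransGen E x b := by
  refine ⟨fun h => h.tail hab, fun h => ?_⟩
  obtain ⟨c, hxc, hcb⟩ := Relation.TransGen.tail'_iff.mp h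
  obtain rfl := hpred c hcb
  exact (Relation.reflTransGen_iff_eq_or_transGen.mp hxc).resolve_left hxa.symm

/-- Every path out of `a` into `x ≠ b` passes through the only successor `b` of `a`. -/
theorem transGen_iff_of_unique_succ {E : V → V → Prop} {a b x : V} (hab : E a b)
    (hsucc : ∀ c, E a c → c = b) (hxb : x ≠ b) :
    Relation.TransGen E a x ↔ Relation.TransGen E b x := by
  refine ⟨fun h => ?_, fun h => h.head hab⟩
  obtain ⟨c, hac, hcx⟩ := Relation.TransGen.head'_iff.mp h
  obtain rfl := hsucc c hac
  exact (Relation.reflTransGen_iff_eq_or_transGen.mp hcx).resolve_left hxb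

/-- if `seq(a,b)` holds then `{a,b}` is a module of the transitive closure,
and `(a,b)` is an edge of the transitive closure. -/
theorem stmt6 {V : Type*} [Fintype V] (E : V → V → Prop) (hirr : Irreflexive E)
    (a b : V) (h : SeqR E a b) :
    IsModule (TClos E) {a, b} ∧ TClos E a b := by
  obtain ⟨hne, hab, hsucc, hpred⟩ := h
  refine ⟨⟨⟨a, Set.mem_insert a {b}⟩, fun x hx => ?_⟩, hne, .single hab⟩
  simp only [Set.mem_insert_iff, Set.mem_singleton_iff, not_or] at hx
  obtain ⟨hxa, hxb⟩ := hx
  have hin : TClos E x a ↔ TClos E x b :=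
    and_congr (iff_of_true hxa hxb) (transGen_iff_of_unique_pred hab hpred hxa)
  have hout : TClos E a x ↔ TClos E b x :=
    and_congr (iff_of_true (Ne.symm hxa) (Ne.symm hxb)) (transGen_iff_of_unique_succ hab hsucc hxb)
  rintro c (rfl | rfl) d (rfl | rfl)
  · exact ⟨Iff.rfl, Iff.rfl⟩
  · exact ⟨hin, hout⟩
  · exact ⟨hin.symm, hout.symm⟩
  · exact ⟨Iff.rfl, Iff.rfl⟩

end PaperMD
end

section
/- Let G = (V, E) be a digraph and let a ≠ b be vertices with par(a,b). Then {a, b} is a module of the transitive closure G* of G. If moreover G is acyclic, then neither (a,b) nor (b,a) is an edge of G*. -/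
namespace PaperMD

variable {V : Type*}

theorem transGen_right_congr {E : V → V → Prop} {a b : V} (h : ∀ c, E c a ↔ E c b) (x : V) :
    Relation.TransGen E x a ↔ Relation.TransGen E x b := by
  simp only [Relation.TransGen.tail'_iff, h]

theorem transGen_left_congr {E : V → V → Prop} {a b : V} (h : ∀ c, E a c ↔ E b c) (x : V) :
    Relation.TransGen E a x ↔ Relation.TransGen E b x := by
  simp only [Relation.TransGen.head'_iff, h]

/-- if `par(a,b)` holds then `{a,b}` is a module of the transitive closure,
and if `G` is moreover acyclic, neither `(a,b)` nor `(b,a)` is an edge of it. -/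
theorem stmt7 {V : Type*} [Fintype V] (E : V → V → Prop) (hirr : Irreflexive E)
    (a b : V) (hab : a ≠ b) (h : ParR E a b) :
    IsModule (TClos E) {a, b} ∧
      (Acyclic E → ¬TClos E a b ∧ ¬TClos E b a) := by
  have hpred := transGen_right_congr fun c => (h.2 c).1
  have hsucc := transGen_left_congr fun c => (h.2 c).2
  refine ⟨⟨⟨a, Set.mem_insert a {b}⟩, ?_⟩, fun hac =>
    ⟨fun hE => hac a ((hpred a).2 hE.2), fun hE => hac a ((hsucc a).2 hE.2)⟩⟩
  intro x hx
  obtain ⟨hxa, hxb⟩ : x ≠ a ∧ x ≠ b := by simpa using hx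
  have to_pair : ∀ u ∈ ({a, b} : Set V), (TClos E x u ↔ Relation.TransGen E x a) ∧
      (TClos E u x ↔ Relation.TransGen E a x) := by
    rintro u (rfl | rfl)
    · simp [TClos, hxa, hxa.symm]
    · simp [TClos, hxb, hxb.symm, hpred, hsucc]
  intro u hu v hv
  exact ⟨(to_pair u hu).1.trans (to_pair v hv).1.symm,
    (to_pair u hu).2.trans (to_pair v hv).2.symm⟩

end PaperMD
end

section
/- Let G = (V, E) be an acyclic, transitively reduced digraph, and let a ≠ b be vertices such that {a, b} is a module of the transitive closure G* of G and (a,b) ∈ E. Then a is the only predecessor of b in G and b is the only successor of a in G (i.e., seq(a,b) holds). -/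
namespace PaperMD

variable {V : Type*}

/-- in an acyclic, transitively reduced digraph, a 2-element module `{a,b}`
of the transitive closure with `(a,b) ∈ E` yields `seq(a,b)`. -/
theorem stmt8 {V : Type*} [Fintype V] (E : V → V → Prop) (hirr : Irreflexive E)
    (hacyc : Acyclic E) (hred : TransReduced E)
    (a b : V) (hab : a ≠ b) (hmod : IsModule (TClos E) {a, b}) (he : E a b) :
    SeqR E a b := by
  have hself : ∀ x, ¬E x x := fun x h => hacyc x (.single h)
  refine ⟨hab, he, fun c hc => ?_, fun c hc => ?_⟩
  · by_contra hcb
    have hca : c ≠ a := fun h => hself a (h ▸ hc)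
    have hbc : TClos E b c :=
      (hmod.2 c (by simp [hca, hcb]) a (by simp) b (by simp)).2.1 ⟨hca.symm, .single hc⟩
    exact hred a c hc ⟨b, he, hbc.2⟩
  · by_contra hca
    have hcb : c ≠ b := fun h => hself b (h ▸ hc)
    have hpath : TClos E c a :=
      (hmod.2 c (by simp [hca, hcb]) a (by simp) b (by simp)).1.2 ⟨hcb, .single hc⟩
    obtain ⟨x, hcx, hxa⟩ := Relation.TransGen.head'_iff.1 hpath.2
    exact hred c b hc ⟨x, hcx, .tail' hxa he⟩

end PaperMD
end

section
/- Let G = (V, E) be an acyclic, transitively reduced digraph, and let a ≠ b be vertices such that {a, b} is a module of the transitive closure G* of G and neither (a,b) ∈ E nor (b,a) ∈ E. Then a and b have the same predecessor sets and the same successor sets in G (i.e., par(a,b) holds). -/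
namespace PaperMD

variable {V : Type*}

theorem TransReduced.not_edge_of_transGen {E : V → V → Prop} (hred : TransReduced E)
    {a b c : V} (hac : Relation.TransGen E a c) (hcb : Relation.TransGen E c b) : ¬E a b := by
  intro hab
  obtain ⟨d, had, hdc⟩ := Relation.TransGen.head'_iff.1 hac
  exact hred a b hab ⟨d, had, Relation.TransGen.trans_right hdc hcb⟩

theorem IsModule.transGen_iff {E : V → V → Prop} {M : Set V} (hmod : IsModule (TClos E) M)
    {x a b : V} (hx : x ∉ M) (ha : a ∈ M) (hb : b ∈ M) :
    (Relation.TransGen E x a ↔ Relation.TransGen E x b) ∧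
      (Relation.TransGen E a x ↔ Relation.TransGen E b x) := by
  have hxa : x ≠ a := fun h => hx (h ▸ ha)
  have hxb : x ≠ b := fun h => hx (h ▸ hb)
  simpa [TClos, hxa, hxb, hxa.symm, hxb.symm] using hmod.2 x hx a ha b hb

theorem edge_to_of_module {E : V → V → Prop} (hacyc : Acyclic E) (hred : TransReduced E)
    {a b : V} (hmod : IsModule (TClos E) {a, b}) (hnab : ¬E a b) (hnba : ¬E b a)
    {c : V} (hca : E c a) : E c b := by
  have not_mem : ∀ {d}, E d a ∨ E d b → d ∉ ({a, b} : Set V) := by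
    rintro d hd (rfl | rfl)
    · exact hd.elim (fun h => hacyc _ (.single h)) hnab
    · exact hd.elim hnba (fun h => hacyc _ (.single h))
  have hcb := (hmod.transGen_iff (a := a) (b := b) (not_mem (.inl hca))
    (by simp) (by simp)).1.1 (.single hca)
  obtain ⟨d, hcd, hdb⟩ := Relation.TransGen.tail'_iff.1 hcb
  obtain rfl | hcd := Relation.reflTransGen_iff_eq_or_transGen.1 hcd
  · exact hdb
  · have hda := (hmod.transGen_iff (a := a) (b := b) (not_mem (.inr hdb))
      (by simp) (by simp)).1.2 (.single hdb)
    exact (hred.not_edge_of_transGen hcd hda hca).elim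

theorem edge_from_of_module {E : V → V → Prop} (hacyc : Acyclic E) (hred : TransReduced E)
    {a b : V} (hmod : IsModule (TClos E) {a, b}) (hnab : ¬E a b) (hnba : ¬E b a)
    {c : V} (hac : E a c) : E b c := by
  have not_mem : ∀ {d}, E a d ∨ E b d → d ∉ ({a, b} : Set V) := by
    rintro d hd (rfl | rfl)
    · exact hd.elim (fun h => hacyc _ (.single h)) hnba
    · exact hd.elim hnab (fun h => hacyc _ (.single h))
  have hbc := (hmod.transGen_iff (a := a) (b := b) (not_mem (.inl hac))
    (by simp) (by simp)).2.1 (.single hac)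
  obtain ⟨d, hbd, hdc⟩ := Relation.TransGen.head'_iff.1 hbc
  obtain rfl | hdc := Relation.reflTransGen_iff_eq_or_transGen.1 hdc
  · exact hbd
  · have had := (hmod.transGen_iff (a := a) (b := b) (not_mem (.inr hbd))
      (by simp) (by simp)).2.2 (.single hbd)
    exact (hred.not_edge_of_transGen had hdc hac).elim

/-- in an acyclic, transitively reduced digraph, a 2-element module `{a,b}`
of the transitive closure with no edge between `a` and `b` yields `par(a,b)`. -/
theorem stmt9 {V : Type*} [Fintype V] (E : V → V → Prop) (hirr : Irreflexive E)
    (hacyc : Acyclic E) (hred : TransReduced E)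
    (a b : V) (hab : a ≠ b) (hmod : IsModule (TClos E) {a, b})
    (hnab : ¬E a b) (hnba : ¬E b a) :
    ParR E a b := by
  have hmod' : IsModule (TClos E) {b, a} := Set.pair_comm a b ▸ hmod
  exact ⟨hab, fun c =>
    ⟨⟨edge_to_of_module hacyc hred hmod hnab hnba, edge_to_of_module hacyc hred hmod' hnba hnab⟩,
      ⟨edge_from_of_module hacyc hred hmod hnab hnba,
        edge_from_of_module hacyc hred hmod' hnba hnab⟩⟩⟩

end PaperMD
end

section
/- Let G = (V, E) be a digraph and G* its transitive closure. Suppose (a,x) and (b,x) are edges of the undirected complement of G* (the complement of U(G*)), suppose (a,b) is an edge of G*, and let a → v₁ → v₂ → ... → vₙ → b be a directed path in E from a to b. Then for each 1 ≤ i ≤ n, the pair (x, v_i) is an edge of the undirected complement of G (i.e., x ≠ v_i, (x,v_i) ∉ E and (v_i,x) ∉ E); consequently the chain of direct forcings (a,x) Γ (v₁,x) Γ (v₂,x) Γ ... Γ (vₙ,x) Γ (b,x) holds in the undirected complement of G. -/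
namespace PaperMD

variable {V : Type*}

/-- Along a directed path that stays in vertices not reaching `x`, towards a vertex `b` not
reachable from `x`, no vertex is adjacent to `x`, so the edges to `x` force each other. -/
theorem forces_chain_of_not_reachable {E : V → V → Prop}
    (hirr : ∀ v, ¬E v v) {b x : V}
    (hxb : ¬Relation.ReflTransGen E x b) (l : List V) :
    ∀ c : V, ¬Relation.ReflTransGen E c x → UComp E c x → List.IsChain E (c :: (l ++ [b])) →
      (∀ v ∈ l, UComp E x v) ∧
        List.IsChain (Forces (UComp E)) ((c, x) :: (l.map (fun v => (v, x)) ++ [(b, x)])) := by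
  have adj_free : ∀ v : V, ¬Relation.ReflTransGen E v x → Relation.ReflTransGen E v b →
      UComp E v x := fun v hvx hvb =>
    ⟨fun h => hvx (h ▸ .refl), fun h => hvx (.single h), fun h => hxb (.head h hvb)⟩
  have force : ∀ c v : V, E c v → UComp E c x → UComp E v x →
      Forces (UComp E) (c, x) (v, x) := fun c v hcv hc hv =>
    ⟨hc, hv, Or.inr ⟨rfl, fun h : c = v => hirr v (h ▸ hcv), fun h => h.2.1 hcv⟩⟩
  induction l with
  | nil =>
    intro c hcx hc hchain
    have hcb : E c b := by simpa using hchain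
    have hbx : ¬Relation.ReflTransGen E b x := fun h => hcx (.head hcb h)
    simpa using force c b hcb hc (adj_free b hbx .refl)
  | cons v l ih =>
    intro c hcx hc hchain
    obtain ⟨hcv, hchain⟩ := List.isChain_cons_cons.mp hchain
    have hvx : ¬Relation.ReflTransGen E v x := fun h => hcx (.head hcv h)
    have hvb : Relation.ReflTransGen E v b :=
      List.relationReflTransGen_of_exists_isChain_cons _ hchain (by simp)
    have hv := adj_free v hvx hvb
    obtain ⟨hl, hforces⟩ := ih v hvx hv hchain
    refine ⟨?_, List.isChain_cons_cons.mpr ⟨force c v hcv hc hv, hforces⟩⟩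
    rintro w (_ | ⟨_, hw⟩)
    · exact ⟨hv.1.symm, hv.2.2, hv.2.1⟩
    · exact hl w hw

/-- if `(a,x)` and `(b,x)` are edges of the undirected complement of `G*`,
`(a,b)` is an edge of `G*`, and `a → v₁ → ⋯ → vₙ → b` is a directed path in `E`, then
each `(x, vᵢ)` is an edge of the undirected complement of `G`, and the chain of direct
forcings `(a,x) Γ (v₁,x) Γ ⋯ Γ (vₙ,x) Γ (b,x)` holds in the undirected complement of `G`. -/
theorem stmt12 {V : Type*} [Fintype V] (E : V → V → Prop) (hirr : Irreflexive E)
    (a b x : V) (hax : UComp (TClos E) a x) (hbx : UComp (TClos E) b x)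
    (hab : TClos E a b) (l : List V) (hpath : List.Chain E a (l ++ [b])) :
    (∀ v ∈ l, UComp E x v) ∧
      List.Chain (Forces (UComp E)) (a, x)
        (l.map (fun v => (v, x)) ++ [(b, x)]) := by
  have not_reaches : ∀ {u v : V}, u ≠ v → ¬TClos E u v → ¬Relation.ReflTransGen E u v :=
    fun hne h hr => (Relation.reflTransGen_iff_eq_or_transGen.mp hr).elim
      (fun heq => hne heq.symm) fun ht => h ⟨hne, ht⟩
  exact forces_chain_of_not_reachable hirr (not_reaches hbx.1.symm hbx.2.2) l a
    (not_reaches hax.1 hax.2.1) ⟨hax.1, fun h => hax.2.1 ⟨hax.1, .single h⟩,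
      fun h => hax.2.2 ⟨hax.1.symm, .single h⟩⟩ hpath

end PaperMD
end

section
/- Let G = (V, E) be a digraph, let H₁ be the undirected complement of G (the complement of U(G)) with edge set D₁, and let H₂ be the undirected complement of the transitive closure G* of G (the complement of U(G*)) with edge set D₂ ⊆ D₁. If (V, F) is a transitive orientation of H₁, then (V, F ∩ D₂) is a transitive orientation of H₂. -/
namespace PaperMD

variable {V : Type*}

theorem IsTransOrientation.asymm {D F : V → V → Prop} (hF : IsTransOrientation D F) {a b : V}
    (hab : F a b) : ¬F b a := by
  rcases hF.1.2 a b (hF.1.1 a b hab) with h | h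
  · exact h.2
  · exact absurd hab h.2

/-- The ends of a non-edge `x y` of `D` lie on the same side of a common neighbour `b`. -/
theorem IsTransOrientation.imp_of_not_adj {D F : V → V → Prop} (hF : IsTransOrientation D F)
    {x y b : V} (hxy : ¬D x y) (hyb : D y b) (h : F x b) : F y b := by
  by_contra hn
  have hby : F b y := (hF.1.2 y b hyb).elim (fun h' => absurd h'.1 hn) And.left
  have hne : x ≠ y := by
    rintro rfl
    exact hn h
  exact hxy (hF.1.1 x y (hF.2 x b y h hby hne))

/-- The direction of `F` towards `b` is constant along a directed path whose vertices are all
incomparable to `b` in the reachability order. -/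
theorem IsTransOrientation.iff_of_path {E F : V → V → Prop} (hF : IsTransOrientation (UComp E) F)
    {x y b : V} (hxy : Relation.ReflTransGen E x y) (hby : ¬Relation.ReflTransGen E b y)
    (hxb : ¬Relation.ReflTransGen E x b) : F x b ↔ F y b := by
  have adj : ∀ {z}, Relation.ReflTransGen E z y → ¬Relation.ReflTransGen E z b →
      UComp E z b := fun hzy hzb =>
    ⟨fun h => hzb (h ▸ .refl), fun h => hzb (.single h), fun h => hby (.head h hzy)⟩
  induction hxy using Relation.ReflTransGen.head_induction_on with
  | refl => rfl
  | @head x z hxz hzy ih =>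
    have hzb : ¬Relation.ReflTransGen E z b := fun h => hxb (.head hxz h)
    refine Iff.trans ?_ (ih hzb)
    exact ⟨hF.imp_of_not_adj (fun h => h.2.1 hxz) (adj hzy hzb),
      hF.imp_of_not_adj (fun h => h.2.2 hxz) (adj (.head hxz hzy) hxb)⟩

theorem UComp.not_reachable {E : V → V → Prop} {a b : V} (h : UComp (TClos E) a b) :
    ¬Relation.ReflTransGen E a b ∧ ¬Relation.ReflTransGen E b a := by
  simp only [Relation.reflTransGen_iff_eq_or_transGen]
  exact ⟨fun h' => h'.elim h.1.symm fun t => h.2.1 ⟨h.1, t⟩,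
    fun h' => h'.elim h.1 fun t => h.2.2 ⟨h.1.symm, t⟩⟩

/-- a transitive orientation of the undirected complement of `G`, restricted
to the edges of the undirected complement of `G*`, transitively orients the latter. -/
theorem stmt13 {V : Type*} [Fintype V] (E : V → V → Prop) (hirr : Irreflexive E)
    (F : V → V → Prop) (hF : IsTransOrientation (UComp E) F) :
    IsTransOrientation (UComp (TClos E))
      (fun a b => F a b ∧ UComp (TClos E) a b) := by
  refine ⟨⟨fun a b h => h.2, fun a b hab => ?_⟩, ?_⟩
  · have hba : UComp (TClos E) b a := ⟨hab.1.symm, hab.2.2, hab.2.1⟩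
    have hE : UComp E a b :=
      ⟨hab.1, fun h => hab.2.1 ⟨hab.1, .single h⟩, fun h => hab.2.2 ⟨hab.1.symm, .single h⟩⟩
    simpa only [hab, hba, and_true] using hF.1.2 a b hE
  · rintro a b c ⟨hab, rab⟩ ⟨hbc, rbc⟩ hac
    have hcb : ¬F c b := hF.asymm hbc
    obtain ⟨nab, nba⟩ := rab.not_reachable
    obtain ⟨nbc, ncb⟩ := rbc.not_reachable
    exact ⟨hF.2 a b c hab hbc hac, hac,
      fun h => hcb ((hF.iff_of_path h.2.to_reflTransGen nbc nab).1 hab),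
      fun h => hcb ((hF.iff_of_path h.2.to_reflTransGen nba ncb).2 hab)⟩

end PaperMD
end

section
/- Let G = (V, E) be a transitive digraph, let M be a module of the undirected closure U(G), and suppose there is a vertex x ∈ V \ M for which M_P := {a ∈ M : (a,x) ∈ E} and M_S := {a ∈ M : (x,a) ∈ E} are both nonempty. Define X := {x' ∈ V \ M : {a ∈ M : (a,x') ∈ E} = M_P and {a ∈ M : (x',a) ∈ E} = M_S}. Then M ∪ X is a module of U(G), and every vertex of M is adjacent in U(G) to every vertex of X (for all m ∈ M, x' ∈ X: (m,x') ∈ E or (x',m) ∈ E). -/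
namespace PaperMD

variable {V : Type*}

/-- Let `x` be adjacent to every vertex of the module `M` and split it into nonempty sets of
predecessors and successors. A vertex outside `M` that splits `M` differently is adjacent to `x`
exactly if it is adjacent to the vertices of `M`. -/
theorem uClos_iff_of_split_ne {V : Type*} {E : V → V → Prop} (htrans : TransRel E)
    {M : Set V} (hM : IsModule (UClos E) M) {x y m : V}
    (hP : {a ∈ M | E a x}.Nonempty) (hS : {a ∈ M | E x a}.Nonempty)
    (hadj : ∀ a ∈ M, E a x ∨ E x a) (hyM : y ∉ M) (hyx : y ≠ x)
    (hy : ¬({a ∈ M | E a y} = {a ∈ M | E a x} ∧ {a ∈ M | E y a} = {a ∈ M | E x a}))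
    (hm : m ∈ M) : UClos E y x ↔ UClos E y m := by
  have ne : ∀ a ∈ M, y ≠ a := fun a ha h => hyM (h ▸ ha)
  constructor
  · rintro (h | h)
    · obtain ⟨s, hs, hxs⟩ := hS
      exact (hM.2 y hyM s hs m hm).1.1 (.inl (htrans y x s h hxs (ne s hs)))
    · obtain ⟨p, hp, hpx⟩ := hP
      exact (hM.2 y hyM p hp m hm).1.1 (.inr (htrans p x y hpx h (ne p hp).symm))
  · intro h
    have hall : ∀ a ∈ M, E y a ∨ E a y := fun a ha => (hM.2 y hyM m hm a ha).1.1 h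
    by_contra hn
    have hpred : ∀ a, E a x → ¬E y a := fun a hax hya => hn (.inl (htrans y a x hya hax hyx))
    have hsucc : ∀ a, E x a → ¬E a y := fun a hxa hay =>
      hn (.inr (htrans x a y hxa hay hyx.symm))
    refine hy ⟨?_, ?_⟩ <;> ext a <;> refine and_congr_right fun ha => ?_
    · exact ⟨fun h => (hadj a ha).resolve_right fun h' => hsucc a h' h,
        fun h => (hall a ha).resolve_left (hpred a h)⟩
    · exact ⟨fun h => (hadj a ha).resolve_left fun h' => hpred a h' h,
        fun h => (hall a ha).resolve_right (hsucc a h)⟩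

/-- for a transitive digraph `G`, a module `M` of `U(G)` split by some
outside vertex `x` into nonempty `M_P`, `M_S`, with `X` the set of outside vertices
splitting `M` the same way: `M ∪ X` is a module of `U(G)` and every vertex of `M`
is adjacent in `U(G)` to every vertex of `X`. -/
theorem stmt14 {V : Type*} [Fintype V] (E : V → V → Prop) (hirr : Irreflexive E)
    (htrans : TransRel E) (M : Set V) (hM : IsModule (UClos E) M)
    (x : V) (hx : x ∉ M)
    (hP : {a ∈ M | E a x}.Nonempty) (hS : {a ∈ M | E x a}.Nonempty)
    (X : Set V)
    (hX : X = {x' | x' ∉ M ∧ {a ∈ M | E a x'} = {a ∈ M | E a x} ∧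
      {a ∈ M | E x' a} = {a ∈ M | E x a}}) :
    IsModule (UClos E) (M ∪ X) ∧
      ∀ m ∈ M, ∀ x' ∈ X, E m x' ∨ E x' m := by
  have hadj₀ : ∀ a ∈ M, E a x ∨ E x a := by
    obtain ⟨p, hp, hpx⟩ := hP
    exact fun a ha => (hM.2 x hx p hp a ha).2.1 (.inl hpx)
  have hadj : ∀ m ∈ M, ∀ x' ∈ X, E m x' ∨ E x' m := by
    subst hX
    rintro m hm x' ⟨-, h₁, h₂⟩
    exact (hadj₀ m hm).imp (fun h => (h₁.ge ⟨hm, h⟩).2) (fun h => (h₂.ge ⟨hm, h⟩).2)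
  refine ⟨⟨hM.1.inl, fun y hy => ?_⟩, hadj⟩
  rw [Set.mem_union, not_or] at hy
  obtain ⟨hyM, hyX⟩ := hy
  obtain ⟨m, hm⟩ := hM.1
  have key : ∀ a ∈ M ∪ X, (UClos E y a ↔ UClos E y m) := by
    rintro a (ha | ha)
    · exact (hM.2 y hyM a ha m hm).1
    · have hya : y ≠ a := fun h => hyX (h ▸ ha)
      have haX := ha
      rw [hX] at haX hyX
      obtain ⟨-, h₁, h₂⟩ := haX
      refine uClos_iff_of_split_ne htrans hM (h₁ ▸ hP) (h₂ ▸ hS)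
        (fun b hb => hadj b hb a ha) hyM hya (fun h => hyX ?_) hm
      exact ⟨hyM, h.1.trans h₁, h.2.trans h₂⟩
  have symm : ∀ a, UClos E a y ↔ UClos E y a := fun _ => or_comm
  intro a ha b hb
  have h := (key a ha).trans (key b hb).symm
  exact ⟨h, (symm a).trans (h.trans (symm b).symm)⟩

end PaperMD
end

section
/- There exists a digraph G = (V, E) (one exists on a vertex set of 5 vertices) such that the undirected complement of the transitive closure G* of G admits a transitive orientation, while the undirected complement of G itself admits no transitive orientation. -/
namespace PaperMD

variable {V : Type*}

/-- there is a digraph on 5 vertices whose transitive closure has a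
transitively orientable undirected complement, while the digraph's own undirected
complement admits no transitive orientation. -/
theorem stmt16 :
    ∃ E : Fin 5 → Fin 5 → Prop, Irreflexive E ∧
      (∃ F : Fin 5 → Fin 5 → Prop, IsTransOrientation (UComp (TClos E)) F) ∧
      ¬∃ F : Fin 5 → Fin 5 → Prop, IsTransOrientation (UComp E) F := by
  refine ⟨fun a b => b = a + 1, (by decide : ∀ a : Fin 5, ¬a = a + 1), ⟨fun _ _ => False, ?_⟩, ?_⟩
  · have step : ∀ a : Fin 5, Relation.TransGen (fun a b : Fin 5 => b = a + 1) a (a + 1) :=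
      fun a => .single rfl
    have reach : ∀ a b : Fin 5, a ≠ b → Relation.TransGen (fun a b : Fin 5 => b = a + 1) a b := by
      intro a b hab
      have hb : ∀ a b : Fin 5, a ≠ b →
          b = a + 1 ∨ b = a + 1 + 1 ∨ b = a + 1 + 1 + 1 ∨ b = a + 1 + 1 + 1 + 1 := by decide
      rcases hb a b hab with rfl | rfl | rfl | rfl
      · exact step _
      · exact (step _).trans (step _)
      · exact ((step _).trans (step _)).trans (step _)
      · exact (((step _).trans (step _)).trans (step _)).trans (step _)
    exact ⟨⟨fun _ _ h => h.elim, fun a b h => (h.2.1 ⟨h.1, reach a b h.1⟩).elim⟩,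
      fun _ _ _ h => h.elim⟩
  · rintro ⟨F, ⟨hsub, hor⟩, htrans⟩
    have hD : ∀ a : Fin 5, F a (a + 2) ∧ ¬F (a + 2) a ∨ F (a + 2) a ∧ ¬F a (a + 2) :=
      fun a => hor _ _ (by unfold UComp; revert a; decide)
    have hne : ∀ a : Fin 5, a ≠ a + 4 := by decide
    have hnot : ∀ a : Fin 5, ¬F a (a + 4) ∧ ¬F (a + 4) a := by
      refine fun a => ⟨fun h => ?_, fun h => ?_⟩
      · exact (hsub _ _ h).2.2 ((by decide : ∀ a : Fin 5, a = a + 4 + 1) a)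
      · exact (hsub _ _ h).2.1 ((by decide : ∀ a : Fin 5, a = a + 4 + 1) a)
    have alternate : ∀ a : Fin 5, F a (a + 2) ↔ ¬F (a + 2) (a + 2 + 2) := by
      intro a
      have e : a + 2 + 2 = a + 4 := by revert a; decide
      have h₁ := hD a
      have h₂ := hD (a + 2)
      rw [e] at h₂ ⊢
      have h₃ := htrans a (a + 2) (a + 4)
      have h₄ := htrans (a + 4) (a + 2) a
      have h₅ := hnot a
      have h₆ := hne a
      have h₇ := (hne a).symm
      tauto
    have h₀ : F 0 2 ↔ ¬F 2 4 := alternate 0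
    have h₁ : F 2 4 ↔ ¬F 4 1 := alternate 2
    have h₂ : F 4 1 ↔ ¬F 1 3 := alternate 4
    have h₃ : F 1 3 ↔ ¬F 3 0 := alternate 1
    have h₄ : F 3 0 ↔ ¬F 0 2 := alternate 3
    tauto

end PaperMD
end
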